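/- For any topological space (X,τ): if τ^{ddd} = τ^{dd}, then τ^{ddd} = τ^d. (In the paper's notation, G_{3c} ⊆ G_{3b}, and hence G_3 = G_{3b}.) -/

import Mathlib

/-- A set is *saturated* in a topological space if it is an intersection of open sets. -/
def IsSaturatedSet {X : Type*} (t : TopologicalSpace X) (A : Set X) : Prop :=
  ∃ S : Set (Set X), (∀ U ∈ S, t.IsOpen U) ∧ A = ⋂₀ S

/-- The de Groot dual of a topology: the topology generated by taking the compact
saturated sets as a closed base (equivalently, their complements as an open subbase). -/
def deGrootDual {X : Type*} (t : TopologicalSpace X) : TopologicalSpace X :=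
  TopologicalSpace.generateFrom
    {U : Set X | ∃ K : Set X, @IsCompact X t K ∧ IsSaturatedSet t K ∧ U = Kᶜ}

namespace GrootAux

/-- compactness operator relative to a family of admissible sets -/
def rho {X : Type*} (S G : Set (Set X)) : Set (Set X) :=
  {A | A ∈ S ∧ ∀ U : Ultrafilter X, A ∈ U → ∃ x ∈ A, ∀ K ∈ G, K ∈ U → x ∈ K}

section
variable {X : Type*} {S G : Set (Set X)}

lemma rho_anti {G H : Set (Set X)} (h : G ⊆ H) : rho S H ⊆ rho S G := by
  rintro A ⟨hA, hc⟩
  refine ⟨hA, fun U hU => ?_⟩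
  obtain ⟨x, hx, hk⟩ := hc U hU
  exact ⟨x, hx, fun K hK => hk K (h hK)⟩

lemma rho_inter (hS : ∀ A ∈ S, ∀ B ∈ S, A ∩ B ∈ S) (hG : G ⊆ S) {K F : Set X}
    (hK : K ∈ rho S G) (hF : F ∈ G) : K ∩ F ∈ rho S G := by
  refine ⟨hS _ hK.1 _ (hG hF), fun U hU => ?_⟩
  obtain ⟨x, hx, hk⟩ := hK.2 U (Filter.mem_of_superset hU Set.inter_subset_left)
  exact ⟨x, ⟨hx, hk F hF (Filter.mem_of_superset hU Set.inter_subset_right)⟩, hk⟩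

lemma rho_sub : rho S G ⊆ S := fun _ h => h.1

lemma key (hS : ∀ A ∈ S, ∀ B ∈ S, A ∩ B ∈ S) (hG : G ⊆ S) {K C : Set X}
    (hK : K ∈ rho S G) (hC : C ∈ rho S (rho S G)) : C ∩ K ∈ rho S G := by
  refine ⟨hS _ hC.1 _ hK.1, fun U hU => ?_⟩
  have hUK : K ∈ U := Filter.mem_of_superset hU Set.inter_subset_right
  obtain ⟨y, hy, hk⟩ := hC.2 U (Filter.mem_of_superset hU Set.inter_subset_left)
  exact ⟨y, ⟨hy, hk K hK hUK⟩, fun F hF hFU =>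
    (hk (K ∩ F) (rho_inter hS hG hK hF) (Filter.inter_mem hUK hFU)).2⟩

lemma sub3 (hS : ∀ A ∈ S, ∀ B ∈ S, A ∩ B ∈ S) (hG : G ⊆ S) :
    rho S G ⊆ rho S (rho S (rho S G)) := by
  intro K hK
  refine ⟨hK.1, fun U hU => ?_⟩
  by_cases hne : ∃ C ∈ rho S (rho S G), C ∈ U
  · obtain ⟨C, hC, hCU⟩ := hne
    obtain ⟨x, hx, hk⟩ := hC.2 U hCU
    refine ⟨x, hk K hK hU, fun D hD hDU => ?_⟩
    exact (hk _ (key hS hG hK hD) (Filter.inter_mem hDU hU)).1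
  · obtain ⟨x, hx⟩ := U.nonempty_of_mem hU
    exact ⟨x, hx, fun C hC hCU => (hne ⟨C, hC, hCU⟩).elim⟩

lemma sub1 (hS : ∀ A ∈ S, ∀ B ∈ S, A ∩ B ∈ S) (hG : G ⊆ S) {C : Set X}
    (h1 : C ∈ rho S (rho S G)) (h2 : C ∈ rho S (rho S (rho S G))) : C ∈ rho S G := by
  refine ⟨h1.1, fun U hU => ?_⟩
  obtain ⟨z, hz, hk⟩ := h2.2 U hU
  refine ⟨z, hz, fun F hF hFU => ?_⟩
  refine (hk (C ∩ F) ⟨hS _ h1.1 _ (hG hF), fun W hW => ?_⟩ (Filter.inter_mem hU hFU)).2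
  have hWC : C ∈ W := Filter.mem_of_superset hW Set.inter_subset_left
  have hWF : F ∈ W := Filter.mem_of_superset hW Set.inter_subset_right
  by_cases hne : ∃ K ∈ rho S G, K ∈ W
  · obtain ⟨K, hK, hKW⟩ := hne
    obtain ⟨y, hy, hyk⟩ := h1.2 W hWC
    exact ⟨y, ⟨hy, (hyk _ (rho_inter hS hG hK hF) (Filter.inter_mem hKW hWF)).2⟩, hyk⟩
  · obtain ⟨x, hx⟩ := W.nonempty_of_mem hW
    exact ⟨x, hx, fun C hC hCU => (hne ⟨C, hC, hCU⟩).elim⟩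

lemma main_abs (hS : ∀ A ∈ S, ∀ B ∈ S, A ∩ B ∈ S) (hG : G ⊆ S)
    (h : rho S (rho S (rho S (rho S G))) = rho S (rho S (rho S G))) :
    rho S (rho S G) = rho S G := by
  have h13 : rho S (rho S G) = rho S (rho S (rho S (rho S G))) :=
    Set.Subset.antisymm (sub3 hS rho_sub) (rho_anti (sub3 hS hG))
  have h12 := h13.trans h
  apply Set.Subset.antisymm
  · intro C hC
    exact sub1 hS hG hC (h12 ▸ hC)
  · rw [h12]; exact sub3 hS hG

/-- specialization -/
def R (t : TopologicalSpace X) (x y : X) : Prop := ∀ V, t.IsOpen V → x ∈ V → y ∈ V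

lemma sat_iff (t : TopologicalSpace X) (A : Set X) :
    IsSaturatedSet t A ↔ ∀ x ∈ A, ∀ y, R t x y → y ∈ A := by
  constructor
  · rintro ⟨S, hS, rfl⟩ x hx y hxy V hV
    exact hxy V (hS V hV) (hx V hV)
  · intro h
    refine ⟨{V | ∃ y, y ∉ A ∧ V = ⋃₀ {W | t.IsOpen W ∧ y ∉ W}}, ?_, ?_⟩
    · rintro V ⟨y, -, rfl⟩
      exact t.isOpen_sUnion _ fun W hW => hW.1
    · ext x
      constructor
      · rintro hx V ⟨y, hy, rfl⟩
        by_contra hcon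
        refine hy (h x hx y fun W hW hxW => ?_)
        by_contra hyW
        exact hcon ⟨W, ⟨hW, hyW⟩, hxW⟩
      · intro hx
        by_contra hxA
        obtain ⟨W, ⟨_, hW⟩, hxW⟩ := hx _ ⟨x, hxA, rfl⟩
        exact hW hxW

lemma R_gen (g : Set (Set X)) (x y : X) (h : ∀ V ∈ g, x ∈ V → y ∈ V) :
    R (TopologicalSpace.generateFrom g) x y := by
  intro V hV
  change TopologicalSpace.GenerateOpen g V at hV
  induction hV with
  | basic s hs => exact h s hs
  | univ => exact fun _ => trivial
  | inter s t _ _ h1 h2 => exact fun hx => ⟨h1 hx.1, h2 hx.2⟩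
  | sUnion T _ ih =>
    rintro ⟨W, hW, hxW⟩
    exact ⟨W, hW, ih W hW hxW⟩

lemma R_dual (t : TopologicalSpace X) (x y : X) : R (deGrootDual t) x y ↔ R t y x := by
  constructor
  · intro h
    by_contra hcon
    have hop : (deGrootDual t).IsOpen {w | R t y w}ᶜ := by
      apply TopologicalSpace.GenerateOpen.basic
      refine ⟨_, ?_, ?_, rfl⟩
      · letI := t
        rw [isCompact_iff_ultrafilter_le_nhds]
        intro f hf
        refine ⟨y, fun V _ hy => hy, ?_⟩
        rw [le_nhds_iff]
        intro s hy hs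
        exact Filter.mem_of_superset (Filter.le_principal_iff.1 hf) fun w hw => hw s hs hy
      · rw [sat_iff]
        exact fun a ha b hab V hV hy => hab V hV (ha V hV hy)
    exact h _ hop hcon fun V _ hy => hy
  · intro h
    apply R_gen
    rintro V ⟨K, -, hs, rfl⟩ hx hy
    exact hx ((sat_iff t K).1 hs y hy x h)

lemma compact_gen (G : Set (Set X)) (A : Set X) :
    @IsCompact X (TopologicalSpace.generateFrom {U | ∃ K ∈ G, U = Kᶜ}) A ↔
      ∀ U : Ultrafilter X, A ∈ U → ∃ x ∈ A, ∀ K ∈ G, K ∈ U → x ∈ K := by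
  letI := TopologicalSpace.generateFrom {U | ∃ K ∈ G, U = Kᶜ}
  rw [isCompact_iff_ultrafilter_le_nhds]
  refine forall_congr' fun U => ?_
  rw [Filter.le_principal_iff]
  refine imp_congr Iff.rfl (exists_congr fun x => and_congr Iff.rfl ?_)
  rw [TopologicalSpace.nhds_generateFrom]
  simp only [le_iInf_iff, Filter.le_principal_iff]
  constructor
  · intro h K hK hKU
    by_contra hx
    exact Ultrafilter.compl_mem_iff_notMem.1 (h Kᶜ ⟨hx, K, hK, rfl⟩) hKU
  · rintro h s ⟨hx, K, hK, rfl⟩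
    exact Ultrafilter.compl_mem_iff_notMem.2 fun hKU => hx (h K hK hKU)

/-- topology with closed subbase `G` -/
def gen (G : Set (Set X)) : TopologicalSpace X :=
  TopologicalSpace.generateFrom {U | ∃ K ∈ G, U = Kᶜ}

lemma dual_gen (S G : Set (Set X)) (h : ∀ A, IsSaturatedSet (gen G) A ↔ A ∈ S) :
    deGrootDual (gen G) = gen (rho S G) := by
  unfold deGrootDual
  rw [gen]
  congr 1
  ext U
  constructor
  · rintro ⟨K, hc, hs, rfl⟩
    exact ⟨K, ⟨(h K).1 hs, (compact_gen G K).1 hc⟩, rfl⟩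
  · rintro ⟨K, ⟨hs, hc⟩, rfl⟩
    exact ⟨K, (compact_gen G K).2 hc, (h K).2 hs, rfl⟩

lemma rho_congr {G H : Set (Set X)} (h : gen G = gen H) : rho S G = rho S H := by
  ext A
  have h1 := compact_gen G A
  have h2 := compact_gen H A
  change @IsCompact X (gen G) A ↔ _ at h1
  change @IsCompact X (gen H) A ↔ _ at h2
  rw [h] at h1
  exact and_congr Iff.rfl (h1.symm.trans h2)

lemma gen_closed (t : TopologicalSpace X) : gen {F | t.IsOpen Fᶜ} = t := by
  have : {U : Set X | ∃ K ∈ {F : Set X | t.IsOpen Fᶜ}, U = Kᶜ} = {U | t.IsOpen U} := by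
    ext U
    constructor
    · rintro ⟨K, hK, rfl⟩; exact hK
    · intro hU
      exact ⟨Uᶜ, by simpa using hU, by simp⟩
  rw [gen, this]
  exact TopologicalSpace.generateFrom_setOfPred_isOpen t

end

end GrootAux

open GrootAux in
/-- G_{3c} ⊆ G_{3b}: if τ^{ddd} = τ^{dd} then τ^{ddd} = τ^d. -/
theorem G3c_subset_G3b {X : Type*} (t : TopologicalSpace X)
    (h : deGrootDual (deGrootDual (deGrootDual t)) = deGrootDual (deGrootDual t)) :
    deGrootDual (deGrootDual (deGrootDual t)) = deGrootDual t := by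
  have hsym : ∀ x y, R t x y → R t y x := by
    intro x y hxy
    have h2 : R (deGrootDual (deGrootDual t)) x y := by rwa [R_dual, R_dual]
    rw [← h, R_dual, R_dual, R_dual] at h2
    exact h2
  have hd : ∀ s : TopologicalSpace X, (∀ x y, R s x y ↔ R t x y) →
      ∀ x y, R (deGrootDual s) x y ↔ R t x y := by
    intro s hs x y
    rw [R_dual, hs]
    exact ⟨hsym _ _, hsym _ _⟩
  let S : Set (Set X) := {A | IsSaturatedSet t A}
  let G : Set (Set X) := {F | t.IsOpen Fᶜ}
  have hsat : ∀ s : TopologicalSpace X, (∀ x y, R s x y ↔ R t x y) →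
      ∀ A, IsSaturatedSet s A ↔ A ∈ S := by
    intro s hs A
    change _ ↔ IsSaturatedSet t A
    simp only [sat_iff, hs]
  have hS : ∀ A ∈ S, ∀ B ∈ S, A ∩ B ∈ S := by
    intro A hA B hB
    have hA' := (sat_iff t A).1 hA
    have hB' := (sat_iff t B).1 hB
    exact (sat_iff t _).2 fun x hx y hxy => ⟨hA' x hx.1 y hxy, hB' x hx.2 y hxy⟩
  have hG : G ⊆ S := by
    intro F hF
    refine (sat_iff t F).2 fun x hx y hxy => ?_
    by_contra hy
    exact hsym x y hxy _ hF hy hx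
  have h0 : gen G = t := gen_closed t
  have r0 : ∀ x y, R t x y ↔ R t x y := fun _ _ => Iff.rfl
  have r1 := hd _ r0
  have r2 := hd _ r1
  have r3 := hd _ r2
  have e1 : deGrootDual t = gen (rho S G) := by
    have := dual_gen S G (by rw [h0]; exact hsat _ r0)
    rwa [h0] at this
  have e2 : deGrootDual (deGrootDual t) = gen (rho S (rho S G)) := by
    have := dual_gen S (rho S G) (by rw [← e1]; exact hsat _ r1)
    rwa [← e1] at this
  have e3 : deGrootDual (deGrootDual (deGrootDual t)) = gen (rho S (rho S (rho S G))) := by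
    have := dual_gen S (rho S (rho S G)) (by rw [← e2]; exact hsat _ r2)
    rwa [← e2] at this
  have h32 : gen (rho S (rho S (rho S G))) = gen (rho S (rho S G)) := by
    rw [← e3, ← e2, h]
  have := main_abs hS hG (rho_congr h32)
  rw [h, e2, e1, this]
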